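/- Let i ≥ 1 be an integer and let M be a set of singular points of V with |M| = i(q^r − 1)/(q − 1). Then the following are equivalent: (1) |P^⊥ ∩ M| = q^{r−1} + i(q^{r−1} − 1)/(q − 1) for every point P ∈ M; (2) |P^⊥ ∩ M| = i(q^{r−1} − 1)/(q − 1) for every singular point P of V not in M; (3) both (1) and (2) hold, i.e., M is an i-tight set of the parabolic polar space Q(2r, q). -/

import Mathlib

variable {F V : Type*} [Field F] [AddCommGroup V] [Module F V]

/-- The polar form `B_Q(x, y) = Q(x + y) − Q(x) − Q(y)` of a quadratic form `Q`. -/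
def polarB (Q : QuadraticForm F V) (u v : V) : F := Q (u + v) - Q u - Q v

/-- `P` is a singular point: a `1`-dimensional subspace spanned by a nonzero
vector `u` with `Q(u) = 0`. -/
def IsSingularPoint (Q : QuadraticForm F V) (P : Submodule F V) : Prop :=
  ∃ u : V, u ≠ 0 ∧ Q u = 0 ∧ P = Submodule.span F {u}

/-- `P^⊥ ∩ M`: the members of `M` all of whose vectors are orthogonal (with respect
to the polar form of `Q`) to all vectors of `P`. -/
def perpIn (Q : QuadraticForm F V) (P : Submodule F V) (M : Set (Submodule F V)) :
    Set (Submodule F V) :=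
  {R ∈ M | ∀ u ∈ P, ∀ v ∈ R, polarB Q u v = 0}

theorem card_mul_card_fiber [Fintype F] [Fintype V] (W : Submodule F V)
    (f : V →ₗ[F] F) (hf : ∃ w ∈ W, f w ≠ 0) (c : F) :
    Fintype.card F * {w : V | w ∈ W ∧ f w = c}.ncard = Nat.card W := by
  classical
  let g : W →ₗ[F] F := f ∘ₗ W.subtype
  have hg : Function.Surjective g := by
    obtain ⟨w, hw, hne⟩ := hf
    intro a
    refine ⟨(a / f w) • ⟨w, hw⟩, ?_⟩
    simp [g, hne]
  have key : ∀ a : F, Fintype.card {x : W // g x = a} = Fintype.card {x : W // g x = c} := by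
    intro a
    obtain ⟨x, hx⟩ := hg a
    obtain ⟨y, hy⟩ := hg c
    refine Fintype.card_congr ((Equiv.addRight (y - x)).subtypeEquiv fun z => ?_)
    simp [hx, hy, add_sub, sub_eq_iff_eq_add, add_comm]
  have h1 : Fintype.card W = ∑ a : F, Fintype.card {x : W // g x = a} := by
    rw [← Fintype.card_sigma]
    exact Fintype.card_congr (Equiv.sigmaFiberEquiv g).symm
  have h2 : {w : V | w ∈ W ∧ f w = c}.ncard = Fintype.card {x : W // g x = c} := by
    rw [← Nat.card_coe_set_eq, ← Nat.card_eq_fintype_card]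
    exact Nat.card_congr (Equiv.subtypeSubtypeEquivSubtypeInter (· ∈ W) (f · = c)).symm
  rw [h2, Nat.card_eq_fintype_card, h1, Finset.sum_congr rfl fun a _ => key a]
  simp

/-- If each coset `v + W` contained in `S` meets `T` in an affine hyperplane, then `|S| = q |T|`. -/
theorem card_mul_ncard_eq_ncard [Fintype F] [Fintype V] (W : Submodule F V) (S T : Set V)
    (hTS : T ⊆ S) (hS : ∀ v ∈ S, ∀ w ∈ W, v + w ∈ S)
    (h : ∀ v ∈ S, ∃ (f : V →ₗ[F] F) (c : F), (∃ w ∈ W, f w ≠ 0) ∧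
      ∀ w ∈ W, (v + w ∈ T ↔ f w = c)) :
    Fintype.card F * T.ncard = S.ncard := by
  classical
  have h1 : ∀ v ∈ S.toFinset, Fintype.card F *
      ((W : Set V).toFinset.bipartiteAbove (fun v w => v + w ∈ T) v).card = Nat.card W := by
    intro v hv
    obtain ⟨f, c, hf, hT⟩ := h v (by simpa using hv)
    rw [← card_mul_card_fiber W f hf c, ← Set.ncard_coe_finset]
    congr 2
    ext w
    simpa using hT w
  have h2 : ∀ w ∈ (W : Set V).toFinset,
      (S.toFinset.bipartiteBelow (fun v w => v + w ∈ T) w).card = T.ncard := by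
    intro w hw
    have hw : w ∈ W := by simpa using hw
    rw [Set.ncard_eq_toFinset_card']
    refine Finset.card_bij (fun v _ => v + w) ?_ ?_ ?_
    · intro v hv
      simpa using (Finset.mem_bipartiteBelow _ |>.1 hv).2
    · intro a _ b _ hab
      simpa using hab
    · intro t ht
      have ht : t ∈ T := by simpa using ht
      refine ⟨t - w, ?_, by simp⟩
      have := hS t (hTS ht) (-w) (W.neg_mem hw)
      simp [Finset.mem_bipartiteBelow, ht, sub_eq_add_neg, this]
  have h3 := Finset.sum_card_bipartiteAbove_eq_sum_card_bipartiteBelow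
    (s := S.toFinset) (t := (W : Set V).toFinset) (fun v w => v + w ∈ T)
  have h4 := Finset.sum_congr rfl h1
  rw [← Finset.mul_sum, h3, Finset.sum_congr rfl h2] at h4
  have hW : (W : Set V).toFinset.card = Nat.card W := by
    rw [← Set.ncard_eq_toFinset_card', ← Nat.card_coe_set_eq]; rfl
  have hpos : 0 < Nat.card W := Nat.card_pos
  simp only [Finset.sum_const, smul_eq_mul, hW] at h4
  rw [← Set.ncard_eq_toFinset_card' S] at h4
  exact Nat.eq_of_mul_eq_mul_right hpos (by linarith)

theorem card_mul_ncard_singular_not_perp [Fintype F] [Fintype V] (Q : QuadraticForm F V)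
    (X W : Submodule F V) (hWX : W ≤ X) (hW : ∀ w ∈ W, Q w = 0) :
    Fintype.card F * {v : V | (v ∈ X ∧ ∃ w ∈ W, polarB Q v w ≠ 0) ∧ Q v = 0}.ncard =
      {v : V | v ∈ X ∧ ∃ w ∈ W, polarB Q v w ≠ 0}.ncard := by
  refine card_mul_ncard_eq_ncard W _ _ (fun v hv => hv.1) ?_ ?_
  · rintro v ⟨hv, w, hw, hne⟩ x hx
    refine ⟨X.add_mem hv (hWX hx), w, hw, ?_⟩
    have h0 : polarB Q x w = 0 := by simp [polarB, hW, hx, hw, W.add_mem]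
    change QuadraticMap.polar Q x w = 0 at h0
    change QuadraticMap.polar Q (v + x) w ≠ 0
    rwa [QuadraticMap.polar_add_left, h0, add_zero]
  · rintro v ⟨hv, w, hw, hne⟩
    refine ⟨Q.polarBilin v, -Q v, ⟨w, hw, hne⟩, fun x hx => ?_⟩
    have h1 : Q (v + x) = Q v + Q.polarBilin v x := by
      simp [QuadraticMap.polar, hW x hx]
    have h0 : polarB Q x w = 0 := by simp [polarB, hW, hx, hw, W.add_mem]
    change QuadraticMap.polar Q x w = 0 at h0
    have h2 : QuadraticMap.polar Q (v + x) w ≠ 0 := by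
      rwa [QuadraticMap.polar_add_left, h0, add_zero]
    have h3 : (v + x ∈ X ∧ ∃ w ∈ W, polarB Q (v + x) w ≠ 0) :=
      ⟨X.add_mem hv (hWX hx), w, hw, h2⟩
    simp only [Set.mem_ofPred_eq, h3, true_and, h1]
    constructor <;> intro h <;> linear_combination h

theorem ncard_singular_perp [Fintype F] [Fintype V] (Q : QuadraticForm F V)
    (X : Submodule F V) (u : V) (hu : u ∈ X) (hQ : Q u = 0) (hne : ∃ e ∈ X, polarB Q u e ≠ 0) :
    Fintype.card F ^ 2 * {v : V | v ∈ X ∧ Q v = 0}.ncard + Nat.card X =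
      Fintype.card F * Nat.card X +
        Fintype.card F ^ 2 * {v : V | v ∈ X ∧ Q v = 0 ∧ polarB Q u v = 0}.ncard := by
  have h1 := card_mul_ncard_singular_not_perp Q X (Submodule.span F {u})
    ((Submodule.span_singleton_le_iff_mem u X).2 hu) (by
      intro w hw
      obtain ⟨c, rfl⟩ := Submodule.mem_span_singleton.1 hw
      simp [QuadraticMap.map_smul, hQ])
  have h2 : ∀ v, (∃ w ∈ Submodule.span F {u}, polarB Q v w ≠ 0) ↔ ¬ polarB Q u v = 0 := by
    intro v
    have hs : polarB Q u v = polarB Q v u := QuadraticMap.polar_comm Q u v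
    rw [hs]
    constructor
    · rintro ⟨w, hw, h⟩ h0
      obtain ⟨c, rfl⟩ := Submodule.mem_span_singleton.1 hw
      apply h
      change QuadraticMap.polar Q v (c • u) = 0
      change QuadraticMap.polar Q v u = 0 at h0
      rw [QuadraticMap.polar_smul_right, h0, smul_zero]
    · exact fun h => ⟨u, Submodule.mem_span_singleton_self u, h⟩
  simp only [h2] at h1
  have h3 := card_mul_card_fiber X (Q.polarBilin u) hne 0
  have h4 : {v : V | v ∈ X ∧ Q.polarBilin u v = 0}.ncard +
      {v : V | v ∈ X ∧ ¬ polarB Q u v = 0}.ncard = Nat.card X := by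
    rw [← Set.ncard_union_eq (Set.disjoint_left.2 fun v hv hv' => hv'.2 hv.2)]
    · change _ = (X : Set V).ncard
      congr 1
      ext v
      change (v ∈ X ∧ polarB Q u v = 0) ∨ (v ∈ X ∧ ¬ polarB Q u v = 0) ↔ v ∈ X
      tauto
  have h5 : {v : V | v ∈ X ∧ Q v = 0 ∧ polarB Q u v = 0}.ncard +
      {v : V | (v ∈ X ∧ ¬ polarB Q u v = 0) ∧ Q v = 0}.ncard =
      {v : V | v ∈ X ∧ Q v = 0}.ncard := by
    rw [← Set.ncard_union_eq (Set.disjoint_left.2 fun v hv hv' => hv'.1.2 hv.2.2)]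
    congr 1
    ext v
    change (v ∈ X ∧ Q v = 0 ∧ polarB Q u v = 0) ∨ ((v ∈ X ∧ ¬ polarB Q u v = 0) ∧ Q v = 0) ↔
      v ∈ X ∧ Q v = 0
    tauto
  rw [← h5]
  linear_combination Fintype.card F * h1 + Fintype.card F * h4 - h3

theorem mem_of_perp_of_singular (Q : QuadraticForm F V) [FiniteDimensional F V]
    (W : Submodule F V) (hW : ∀ w ∈ W, Q w = 0)
    (hmax : ¬ ∃ W' : Submodule F V, Module.finrank F W' = Module.finrank F W + 1 ∧
      ∀ v ∈ W', Q v = 0)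
    {v : V} (hv : Q v = 0) (hperp : ∀ w ∈ W, polarB Q v w = 0) : v ∈ W := by
  by_contra hvW
  refine hmax ⟨W ⊔ Submodule.span F {v}, ?_, ?_⟩
  · exact Submodule.finrank_sup_span_singleton hvW
  · intro x hx
    obtain ⟨w, hw, y, hy, rfl⟩ := Submodule.mem_sup.1 hx
    obtain ⟨c, rfl⟩ := Submodule.mem_span_singleton.1 hy
    have h : Q.polarBilin v w = 0 := hperp w hw
    have h' : QuadraticMap.polar Q w (c • v) = 0 := by
      rw [QuadraticMap.polar_comm, QuadraticMap.polar_smul_left]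
      simpa using Or.inr h
    rw [QuadraticMap.polar, hW w hw, QuadraticMap.map_smul, hv] at h'
    simpa using h'

theorem ncard_singular_vectors [Fintype F] [Fintype V] (Q : QuadraticForm F V) (r : ℕ)
    (hdim : Module.finrank F V = 2 * r + 1)
    (hnd : ∀ u : V, (∀ v : V, polarB Q u v = 0) → u = 0)
    (hwitt : ∃ W : Submodule F V, Module.finrank F ↥W = r ∧ ∀ v ∈ W, Q v = 0)
    (hwitt' : ¬ ∃ W : Submodule F V, Module.finrank F ↥W = r + 1 ∧ ∀ v ∈ W, Q v = 0) :
    {v : V | Q v = 0}.ncard = Fintype.card F ^ (2 * r) := by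
  obtain ⟨W, hWr, hW⟩ := hwitt
  have h1 := card_mul_ncard_singular_not_perp Q ⊤ W le_top hW
  simp only [Submodule.mem_top, true_and] at h1
  have hndB : Q.polarBilin.Nondegenerate :=
    ⟨fun x hx => hnd x hx, fun x hx => hnd x fun y => by
      have h : QuadraticMap.polar Q y x = 0 := hx y
      rwa [QuadraticMap.polar_comm] at h⟩
  have h2 := LinearMap.BilinForm.finrank_orthogonal hndB W
  rw [hWr, hdim] at h2
  have hcard : ∀ X : Submodule F V, Nat.card X = Fintype.card F ^ Module.finrank F X := by
    intro X
    rw [Module.natCard_eq_pow_finrank (K := F), Nat.card_eq_fintype_card]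
  have h3 : Nat.card (LinearMap.BilinForm.orthogonal Q.polarBilin W) = Fintype.card F ^ (r + 1) := by
    rw [hcard, h2]; congr 1; omega
  have h4 : Nat.card V = Fintype.card F ^ (2 * r + 1) := by
    rw [Module.natCard_eq_pow_finrank (K := F), Nat.card_eq_fintype_card, hdim]
  have horth : ∀ v, v ∈ LinearMap.BilinForm.orthogonal Q.polarBilin W ↔ ∀ w ∈ W, polarB Q v w = 0 := by
    intro v
    rw [LinearMap.BilinForm.mem_orthogonal_iff]
    refine forall₂_congr fun w _ => ?_
    change QuadraticMap.polar Q w v = 0 ↔ QuadraticMap.polar Q v w = 0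
    rw [QuadraticMap.polar_comm]
  have h5 : Nat.card (LinearMap.BilinForm.orthogonal Q.polarBilin W) + {v : V | ∃ w ∈ W, polarB Q v w ≠ 0}.ncard =
      Nat.card V := by
    have hc : {v : V | ∃ w ∈ W, polarB Q v w ≠ 0} = (LinearMap.BilinForm.orthogonal Q.polarBilin W : Set V)ᶜ := by
      ext v
      simp [horth]
    rw [hc, ← Set.ncard_add_ncard_compl (LinearMap.BilinForm.orthogonal Q.polarBilin W : Set V)]
    rfl
  have h6 : Nat.card W + {v : V | (∃ w ∈ W, polarB Q v w ≠ 0) ∧ Q v = 0}.ncard =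
      {v : V | Q v = 0}.ncard := by
    change (W : Set V).ncard + _ = _
    have hperp : ∀ v ∈ W, ∀ w ∈ W, polarB Q v w = 0 := fun v hv w hw => by
      simp [polarB, hW, hv, hw, W.add_mem]
    rw [← Set.ncard_union_eq]
    · congr 1
      ext v
      change v ∈ W ∨ ((∃ w ∈ W, polarB Q v w ≠ 0) ∧ Q v = 0) ↔ Q v = 0
      constructor
      · rintro (h | h)
        exacts [hW v h, h.2]
      · intro h
        by_cases hv : ∃ w ∈ W, polarB Q v w ≠ 0
        · exact Or.inr ⟨hv, h⟩
        · push Not at hv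
          exact Or.inl (mem_of_perp_of_singular Q W hW (by rwa [hWr]) h hv)
    · refine Set.disjoint_left.2 fun v hv hv' => ?_
      obtain ⟨⟨w, hw, hne⟩, -⟩ := hv'
      exact hne (hperp v hv w hw)
  rw [hcard W, hWr] at h6
  rw [h3, h4] at h5
  have hq : 0 < Fintype.card F := Fintype.card_pos
  apply Nat.eq_of_mul_eq_mul_left hq
  rw [← h6, mul_add, h1]
  linear_combination h5

theorem exists_polarB_ne_zero (Q : QuadraticForm F V)
    (hnd : ∀ u : V, (∀ v : V, polarB Q u v = 0) → u = 0) {u : V} (hu : u ≠ 0) :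
    ∃ e, polarB Q u e ≠ 0 := by
  by_contra! h
  exact hu (hnd u h)

theorem exists_perp_polarB_ne_zero (Q : QuadraticForm F V)
    (hnd : ∀ u : V, (∀ v : V, polarB Q u v = 0) → u = 0) {u x : V} (hu : u ≠ 0)
    (hx : x ∉ Submodule.span F {u}) : ∃ e, polarB Q u e = 0 ∧ polarB Q x e ≠ 0 := by
  by_contra! h
  obtain ⟨e, he⟩ := exists_polarB_ne_zero Q hnd hu
  change Q.polarBilin u e ≠ 0 at he
  refine hx (Submodule.mem_span_singleton.2 ⟨Q.polarBilin x e / Q.polarBilin u e, ?_⟩)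
  refine (sub_eq_zero.1 (hnd _ fun v => ?_)).symm
  have h1 : Q.polarBilin x (v - (Q.polarBilin u v / Q.polarBilin u e) • e) = 0 := by
    apply h
    change Q.polarBilin u _ = 0
    rw [map_sub, map_smul, smul_eq_mul, div_mul_cancel₀ _ he, sub_self]
  change Q.polarBilin _ v = 0
  rw [map_sub, map_smul, smul_eq_mul] at h1
  rw [map_sub, map_smul, LinearMap.sub_apply, LinearMap.smul_apply, smul_eq_mul]
  linear_combination h1

theorem ncard_singular_perp_one [Fintype F] [Fintype V] (Q : QuadraticForm F V) (s : ℕ)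
    (hcardV : Nat.card V = Fintype.card F ^ (2 * s + 3))
    (hnd : ∀ u : V, (∀ v : V, polarB Q u v = 0) → u = 0)
    (hZ : {v : V | Q v = 0}.ncard = Fintype.card F ^ (2 * s + 2))
    {u : V} (hu : u ≠ 0) (hQu : Q u = 0) :
    {v : V | Q v = 0 ∧ polarB Q u v = 0}.ncard = Fintype.card F ^ (2 * s + 1) := by
  obtain ⟨e, he⟩ := exists_polarB_ne_zero Q hnd hu
  have h := ncard_singular_perp Q ⊤ u trivial hQu ⟨e, trivial, he⟩
  have h0 : Nat.card (⊤ : Submodule F V) = Nat.card V := Nat.card_congr Submodule.topEquiv.toEquiv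
  rw [h0, hcardV] at h
  simp only [Submodule.mem_top, true_and] at h
  rw [hZ] at h
  have hq : 0 < Fintype.card F ^ 2 := pow_pos Fintype.card_pos 2
  apply Nat.eq_of_mul_eq_mul_left hq
  have : Fintype.card F ^ 2 * Fintype.card F ^ (2 * s + 2) =
    Fintype.card F * Fintype.card F ^ (2 * s + 3) := by ring
  have : Fintype.card F ^ 2 * Fintype.card F ^ (2 * s + 1) = Fintype.card F ^ (2 * s + 3) := by ring
  omega

theorem ncard_singular_perp_two [Fintype F] [Fintype V] (Q : QuadraticForm F V) (s : ℕ)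
    (hcardV : Nat.card V = Fintype.card F ^ (2 * s + 3))
    (hnd : ∀ u : V, (∀ v : V, polarB Q u v = 0) → u = 0)
    (hZ : {v : V | Q v = 0}.ncard = Fintype.card F ^ (2 * s + 2))
    {u x : V} (hu : u ≠ 0) (hQu : Q u = 0) (hQx : Q x = 0)
    (hx : x ∉ Submodule.span F {u}) :
    {v : V | Q v = 0 ∧ polarB Q u v = 0 ∧ polarB Q x v = 0}.ncard =
      Fintype.card F ^ (2 * s) := by
  have h1 := ncard_singular_perp_one Q s hcardV hnd hZ hu hQu
  have hq : 0 < Fintype.card F := Fintype.card_pos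
  by_cases hux : polarB Q u x = 0
  · let X : Submodule F V := LinearMap.ker (Q.polarBilin u)
    have hX : ∀ v, v ∈ X ↔ polarB Q u v = 0 := fun v => LinearMap.mem_ker
    obtain ⟨e, he, hne⟩ := exists_perp_polarB_ne_zero Q hnd hu hx
    obtain ⟨e', he'⟩ := exists_polarB_ne_zero Q hnd hu
    have h := ncard_singular_perp Q X x ((hX x).2 hux) hQx ⟨e, (hX e).2 he, hne⟩
    have h2 := card_mul_card_fiber ⊤ (Q.polarBilin u) ⟨e', trivial, he'⟩ 0
    have h0 : Nat.card (⊤ : Submodule F V) = Nat.card V :=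
      Nat.card_congr Submodule.topEquiv.toEquiv
    rw [h0, hcardV] at h2
    simp only [Submodule.mem_top, true_and] at h2
    change _ * Nat.card X = _ at h2
    rw [pow_succ', Nat.mul_left_cancel_iff hq] at h2
    rw [h2] at h
    simp only [hX] at h
    have h3 : {v : V | polarB Q u v = 0 ∧ Q v = 0} = {v : V | Q v = 0 ∧ polarB Q u v = 0} := by
      ext v; exact and_comm
    have h4 : {v : V | polarB Q u v = 0 ∧ Q v = 0 ∧ polarB Q x v = 0} =
        {v : V | Q v = 0 ∧ polarB Q u v = 0 ∧ polarB Q x v = 0} := by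
      ext v; exact and_left_comm
    rw [h3, h4, h1] at h
    apply Nat.eq_of_mul_eq_mul_left (pow_pos hq 2)
    have : Fintype.card F ^ 2 * Fintype.card F ^ (2 * s + 1) =
      Fintype.card F * Fintype.card F ^ (2 * s + 2) := by ring
    have : Fintype.card F ^ 2 * Fintype.card F ^ (2 * s) = Fintype.card F ^ (2 * s + 2) := by ring
    omega
  · apply Nat.eq_of_mul_eq_mul_left hq
    rw [← pow_succ', ← h1]
    have huu : QuadraticMap.polar Q u u = 0 := by simp [hQu]
    refine card_mul_ncard_eq_ncard (Submodule.span F {u}) _ _ (fun v hv => ⟨hv.1, hv.2.1⟩) ?_ ?_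
    · rintro v ⟨hv, hv'⟩ w hw
      obtain ⟨c, rfl⟩ := Submodule.mem_span_singleton.1 hw
      change QuadraticMap.polar Q u v = 0 at hv'
      constructor
      · rw [QuadraticMap.map_add Q, QuadraticMap.polar_smul_right, QuadraticMap.polar_comm, hv',
          QuadraticMap.map_smul, hQu, hv]
        simp
      · change QuadraticMap.polar Q u _ = 0
        rw [QuadraticMap.polar_add_right, QuadraticMap.polar_smul_right, hv', huu]
        simp
    · rintro v ⟨hv, hv'⟩
      refine ⟨Q.polarBilin x, - Q.polarBilin x v, ⟨u, Submodule.mem_span_singleton_self u, ?_⟩, ?_⟩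
      · change QuadraticMap.polar Q x u ≠ 0
        rwa [QuadraticMap.polar_comm]
      · intro w hw
        obtain ⟨c, rfl⟩ := Submodule.mem_span_singleton.1 hw
        change QuadraticMap.polar Q u v = 0 at hv'
        have h2 : Q (v + c • u) = 0 := by
          rw [QuadraticMap.map_add Q, QuadraticMap.polar_smul_right, QuadraticMap.polar_comm, hv',
            QuadraticMap.map_smul, hQu, hv]
          simp
        have h3 : polarB Q u (v + c • u) = 0 := by
          change QuadraticMap.polar Q u _ = 0
          rw [QuadraticMap.polar_add_right, QuadraticMap.polar_smul_right, hv', huu]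
          simp
        have h4 : polarB Q x (v + c • u) = Q.polarBilin x v + Q.polarBilin x (c • u) :=
          map_add (Q.polarBilin x) _ _
        change Q _ = 0 ∧ _ = 0 ∧ polarB Q x _ = 0 ↔ _
        simp only [h2, h3, h4, true_and]
        rw [add_comm, add_eq_zero_iff_eq_neg]

theorem eq_zero_of_eigenvector {α : Type*} (Y : Finset α) (N : α → α → ℤ) (m w : α → ℤ)
    (l k c : ℤ) (hsymm : ∀ u v, N u v = N v u)
    (hw : ∀ u ∈ Y, w u = ∑ v ∈ Y, N u v * m v - l * m u - c)
    (hN : ∀ u ∈ Y, ∑ v ∈ Y, N u v * w v = -l * w u)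
    (hk : ∀ u ∈ Y, ∑ v ∈ Y, N u v = k) (hlk : 0 < l + k)
    (h : ∑ u ∈ Y, w u * m u = 0 ∨ ∑ u ∈ Y, w u * m u = ∑ u ∈ Y, w u) :
    ∀ u ∈ Y, w u = 0 := by
  have h1 : ∑ u ∈ Y, w u = 0 := by
    have h2 : ∑ u ∈ Y, ∑ v ∈ Y, N u v * w v = k * ∑ v ∈ Y, w v := by
      rw [Finset.sum_comm, Finset.mul_sum]
      refine Finset.sum_congr rfl fun v hv => ?_
      rw [← Finset.sum_mul, ← hk v hv]
      simp only [hsymm v]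
    rw [Finset.sum_congr rfl hN, ← Finset.mul_sum] at h2
    have h3 : (l + k) * ∑ u ∈ Y, w u = 0 := by linear_combination -h2
    exact (mul_eq_zero.1 h3).resolve_left hlk.ne'
  have h0 : ∑ u ∈ Y, w u * m u = 0 := by
    rcases h with h | h
    exacts [h, h.trans h1]
  have h2 : ∑ u ∈ Y, w u * ∑ v ∈ Y, N u v * m v = 0 := by
    calc ∑ u ∈ Y, w u * ∑ v ∈ Y, N u v * m v
        = ∑ v ∈ Y, m v * ∑ u ∈ Y, N v u * w u := by
          simp only [Finset.mul_sum]
          rw [Finset.sum_comm]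
          refine Finset.sum_congr rfl fun v _ => Finset.sum_congr rfl fun u _ => ?_
          rw [hsymm u v]; ring
      _ = ∑ v ∈ Y, -l * (w v * m v) :=
          Finset.sum_congr rfl fun v hv => by rw [hN v hv]; ring
      _ = 0 := by rw [← Finset.mul_sum, h0, mul_zero]
  have h3 : ∑ u ∈ Y, w u * w u = 0 := by
    calc ∑ u ∈ Y, w u * w u
        = ∑ u ∈ Y, (w u * (∑ v ∈ Y, N u v * m v) - l * (w u * m u) - c * w u) :=
          Finset.sum_congr rfl fun u hu => by
            conv_lhs => rw [hw u hu]
            rw [hw u hu]; ring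
      _ = 0 := by
          rw [Finset.sum_sub_distrib, Finset.sum_sub_distrib, ← Finset.mul_sum, ← Finset.mul_sum,
            h2, h0, h1]
          ring
  intro u hu
  exact mul_self_eq_zero.1
    ((Finset.sum_eq_zero_iff_of_nonneg fun u _ => mul_self_nonneg (w u)).1 h3 u hu)

theorem card_singular_vectors_of_points [Fintype F] [Fintype V] [DecidableEq V]
    (Q : QuadraticForm F V) (Y : Finset V) (hY : ∀ v, v ∈ Y ↔ v ≠ 0 ∧ Q v = 0)
    (A : Set (Submodule F V)) (hA : ∀ P ∈ A, IsSingularPoint Q P)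
    [DecidablePred fun v : V => Submodule.span F {v} ∈ A] :
    ((Y.filter fun v => Submodule.span F {v} ∈ A).card : ℤ) =
      ((Fintype.card F : ℤ) - 1) * A.ncard := by
  classical
  have hfin : A.Finite := Set.toFinite A
  have h1 := Finset.card_eq_sum_card_fiberwise (f := fun v : V => Submodule.span F {v})
    (s := Y.filter fun v => Submodule.span F {v} ∈ A) (t := hfin.toFinset) (by
      intro v hv
      simpa using (Finset.mem_filter.1 hv).2)
  have h2 : ∀ P ∈ hfin.toFinset, ({v ∈ Y.filter fun v => Submodule.span F {v} ∈ A |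
      Submodule.span F {v} = P}).card = Fintype.card F - 1 := by
    intro P hP
    have hPA : P ∈ A := by simpa using hP
    obtain ⟨u, hu, hQu, hPu⟩ := hA P hPA
    have h3 : (({v ∈ Y.filter fun v => Submodule.span F {v} ∈ A |
      Submodule.span F {v} = P} : Finset V) : Set V) = (P : Set V) \ {0} := by
      ext v
      simp only [Finset.coe_filter, Finset.mem_filter, hY, Set.mem_ofPred_eq, Set.mem_sdiff,
        SetLike.mem_coe, Set.mem_singleton_iff]
      constructor
      · rintro ⟨⟨⟨hv, -⟩, -⟩, rfl⟩
        exact ⟨Submodule.mem_span_singleton_self v, hv⟩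
      · rintro ⟨hvP, hv⟩
        rw [hPu] at hvP
        obtain ⟨c, rfl⟩ := Submodule.mem_span_singleton.1 hvP
        have hc : c ≠ 0 := by
          rintro rfl
          simp at hv
        have hs : Submodule.span F {c • u} = P := by
          rw [hPu]
          exact Submodule.span_singleton_smul_eq (IsUnit.mk0 c hc) u
        rw [hs]
        refine ⟨⟨⟨hv, ?_⟩, hPA⟩, rfl⟩
        rw [QuadraticMap.map_smul, hQu, smul_zero]
    rw [← Set.ncard_coe_finset, h3, Set.ncard_sdiff_singleton_of_mem P.zero_mem]
    congr 1
    change Nat.card P = _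
    rw [Module.natCard_eq_pow_finrank (K := F), hPu, finrank_span_singleton hu, pow_one,
      Nat.card_eq_fintype_card]
  rw [Finset.sum_congr rfl h2, Finset.sum_const, smul_eq_mul,
    ← Set.ncard_eq_toFinset_card A hfin] at h1
  have hq : 1 ≤ Fintype.card F := Fintype.card_pos
  rw [h1]
  push_cast [hq]
  ring

theorem mem_perpIn_span (Q : QuadraticForm F V) (M : Set (Submodule F V)) (u v : V) :
    Submodule.span F {v} ∈ perpIn Q (Submodule.span F {u}) M ↔
      Submodule.span F {v} ∈ M ∧ polarB Q u v = 0 := by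
  refine and_congr_right fun _ => ⟨fun h => h u (Submodule.mem_span_singleton_self u) v
    (Submodule.mem_span_singleton_self v), fun h x hx y hy => ?_⟩
  obtain ⟨a, rfl⟩ := Submodule.mem_span_singleton.1 hx
  obtain ⟨b, rfl⟩ := Submodule.mem_span_singleton.1 hy
  change QuadraticMap.polar Q u v = 0 at h
  change QuadraticMap.polar Q (a • u) (b • v) = 0
  rw [QuadraticMap.polar_smul_left, QuadraticMap.polar_smul_right, h, smul_zero, smul_zero]

theorem ncard_perpIn_of_or [Fintype F] [Fintype V] (hF : 2 ≤ Fintype.card F)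
    (Q : QuadraticForm F V) (s : ℕ)
    (hcardV : Nat.card V = Fintype.card F ^ (2 * s + 3))
    (hnd : ∀ u : V, (∀ v : V, polarB Q u v = 0) → u = 0)
    (hZ : {v : V | Q v = 0}.ncard = Fintype.card F ^ (2 * s + 2))
    (M : Set (Submodule F V)) (hM : ∀ P ∈ M, IsSingularPoint Q P) (i t : ℤ)
    (hcard : ((Fintype.card F : ℤ) - 1) * M.ncard = i * ((Fintype.card F : ℤ) ^ (s + 1) - 1))
    (ht : ((Fintype.card F : ℤ) - 1) * t = i * ((Fintype.card F : ℤ) ^ s - 1))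
    (h : (∀ P ∈ M, ((perpIn Q P M).ncard : ℤ) = (Fintype.card F : ℤ) ^ s + t) ∨
      ∀ P, IsSingularPoint Q P → P ∉ M → ((perpIn Q P M).ncard : ℤ) = t) :
    (∀ P ∈ M, ((perpIn Q P M).ncard : ℤ) = (Fintype.card F : ℤ) ^ s + t) ∧
      ∀ P, IsSingularPoint Q P → P ∉ M → ((perpIn Q P M).ncard : ℤ) = t := by
  classical
  set q : ℤ := (Fintype.card F : ℤ) with hq
  have hq2 : 2 ≤ q := by rw [hq]; exact_mod_cast hF
  have hqs : 0 < q ^ s := by positivity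
  let Y : Finset V := Finset.univ.filter fun v => v ≠ 0 ∧ Q v = 0
  have hY : ∀ v, v ∈ Y ↔ v ≠ 0 ∧ Q v = 0 := fun v => by simp [Y]
  let N : V → V → ℤ := fun u v => if polarB Q u v = 0 then 1 else 0
  let m : V → ℤ := fun v => if Submodule.span F {v} ∈ M then 1 else 0
  let w : V → ℤ := fun u => ∑ v ∈ Y, N u v * m v - (q - 1) * q ^ s * m u - i * (q ^ s - 1)
  have hsymm : ∀ u v, N u v = N v u := fun u v => by
    have : polarB Q u v = polarB Q v u := QuadraticMap.polar_comm Q u v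
    simp only [N, this]
  have hk : ∀ u ∈ Y, ∑ v ∈ Y, N u v = q ^ (2 * s + 1) - 1 := by
    intro u hu
    obtain ⟨hu0, hQu⟩ := (hY u).1 hu
    have h1 := ncard_singular_perp_one Q s hcardV hnd hZ hu0 hQu
    have h2 : ((Y.filter fun v => polarB Q u v = 0 : Finset V) : Set V) =
        {v : V | Q v = 0 ∧ polarB Q u v = 0} \ {0} := by
      ext v; simp [hY]; tauto
    simp only [N, Finset.sum_boole]
    rw [← Set.ncard_coe_finset, h2, Set.ncard_sdiff_singleton_of_mem (by simp [polarB]), h1,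
      Nat.cast_sub (Nat.one_le_pow _ _ (by omega))]
    simp [hq]
  have hNN : ∀ u ∈ Y, ∀ x ∈ Y, ∑ v ∈ Y, N u v * N v x = q ^ (2 * s) - 1 +
      (q ^ (2 * s + 1) - q ^ (2 * s)) *
        (if Submodule.span F {x} ∈ ({Submodule.span F {u}} : Set (Submodule F V)) then 1 else 0) := by
    intro u hu x hx
    obtain ⟨hu0, hQu⟩ := (hY u).1 hu
    obtain ⟨hx0, hQx⟩ := (hY x).1 hx
    simp only [Set.mem_singleton_iff]
    split_ifs with hux
    · have hxu : ∀ v, polarB Q u v = 0 → polarB Q v x = 0 := fun v hv => by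
        obtain ⟨c, rfl⟩ := Submodule.mem_span_singleton.1
          (hux ▸ Submodule.mem_span_singleton_self x)
        change QuadraticMap.polar Q u v = 0 at hv
        change QuadraticMap.polar Q v (c • u) = 0
        rw [QuadraticMap.polar_smul_right, QuadraticMap.polar_comm, hv, smul_zero]
      have : ∀ v, N u v * N v x = N u v := fun v => by
        by_cases hv : polarB Q u v = 0
        · simp [N, hv, hxu v hv]
        · simp [N, hv]
      simp only [this]
      rw [hk u hu]; ring
    · have hxs : x ∉ Submodule.span F {u} := fun hxu => hux <| by
        obtain ⟨c, rfl⟩ := Submodule.mem_span_singleton.1 hxu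
        have hc : c ≠ 0 := by
          rintro rfl
          simp at hx0
        exact Submodule.span_singleton_smul_eq (IsUnit.mk0 c hc) u
      have h1 := ncard_singular_perp_two Q s hcardV hnd hZ hu0 hQu hQx hxs
      have h2 : ((Y.filter fun v => polarB Q u v = 0 ∧ polarB Q x v = 0 : Finset V) : Set V) =
          {v : V | Q v = 0 ∧ polarB Q u v = 0 ∧ polarB Q x v = 0} \ {0} := by
        ext v; simp [hY]; tauto
      have h3 : ∀ v, N u v * N v x = if polarB Q u v = 0 ∧ polarB Q x v = 0 then 1 else 0 :=
        fun v => by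
          rw [hsymm v x]
          by_cases h4 : polarB Q u v = 0 <;> by_cases h5 : polarB Q x v = 0 <;> simp [N, h4, h5]
      simp only [h3, Finset.sum_boole]
      rw [← Set.ncard_coe_finset, h2, Set.ncard_sdiff_singleton_of_mem (by simp [polarB]), h1,
        Nat.cast_sub (Nat.one_le_pow _ _ (by omega))]
      simp [hq]
  have hm : ∑ x ∈ Y, m x = i * (q ^ (s + 1) - 1) := by
    simp only [m, Finset.sum_boole]
    rw [card_singular_vectors_of_points Q Y hY M hM, hcard]
  have hs : ∀ u, ∑ v ∈ Y, N u v * m v =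
      (q - 1) * (perpIn Q (Submodule.span F {u}) M).ncard := by
    intro u
    rw [← card_singular_vectors_of_points Q Y hY _ fun P hP => hM P hP.1, Finset.card_filter]
    push_cast
    refine Finset.sum_congr rfl fun v _ => ?_
    simp only [mem_perpIn_span]
    by_cases h4 : polarB Q u v = 0 <;> by_cases h5 : Submodule.span F {v} ∈ M <;>
      simp [N, m, h4, h5]
  have hNm : ∀ u ∈ Y, ∑ v ∈ Y, N u v * ∑ x ∈ Y, N v x * m x =
      (q ^ (2 * s) - 1) * (i * (q ^ (s + 1) - 1)) +
        (q ^ (2 * s + 1) - q ^ (2 * s)) * ((q - 1) * m u) := by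
    intro u hu
    have h1 : ∑ x ∈ Y, m x *
        (if Submodule.span F {x} ∈ ({Submodule.span F {u}} : Set (Submodule F V)) then 1 else 0) =
        (q - 1) * m u := by
      have h2 := card_singular_vectors_of_points Q Y hY {Submodule.span F {u}} (by
        rintro P rfl
        exact ⟨u, ((hY u).1 hu).1, ((hY u).1 hu).2, rfl⟩)
      rw [Set.ncard_singleton, Nat.cast_one, mul_one, Finset.card_filter] at h2
      rw [← h2]
      push_cast
      rw [Finset.sum_mul]
      refine Finset.sum_congr rfl fun x _ => ?_
      simp only [Set.mem_singleton_iff]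
      split_ifs with h3
      · simp only [m, h3, mul_one, one_mul]
      · simp
    calc ∑ v ∈ Y, N u v * ∑ x ∈ Y, N v x * m x
        = ∑ x ∈ Y, m x * ∑ v ∈ Y, N u v * N v x := by
          simp only [Finset.mul_sum]
          rw [Finset.sum_comm]
          exact Finset.sum_congr rfl fun _ _ => Finset.sum_congr rfl fun _ _ => by ring
      _ = ∑ x ∈ Y, ((q ^ (2 * s) - 1) * m x + (q ^ (2 * s + 1) - q ^ (2 * s)) * (m x *
            (if Submodule.span F {x} ∈ ({Submodule.span F {u}} : Set (Submodule F V))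
              then 1 else 0))) :=
          Finset.sum_congr rfl fun x hx => by rw [hNN u hu x hx]; ring
      _ = _ := by rw [Finset.sum_add_distrib, ← Finset.mul_sum, ← Finset.mul_sum, hm, h1]
  have hN : ∀ u ∈ Y, ∑ v ∈ Y, N u v * w v = -((q - 1) * q ^ s) * w u := by
    intro u hu
    have h1 : ∑ v ∈ Y, N u v * w v = ∑ v ∈ Y, N u v * ∑ x ∈ Y, N v x * m x -
        (q - 1) * q ^ s * ∑ v ∈ Y, N u v * m v - i * (q ^ s - 1) * ∑ v ∈ Y, N u v := by
      rw [Finset.mul_sum, Finset.mul_sum, ← Finset.sum_sub_distrib, ← Finset.sum_sub_distrib]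
      exact Finset.sum_congr rfl fun v _ => by simp only [w]; ring
    rw [h1, hNm u hu, hk u hu]
    simp only [w]
    ring
  have hwd : ∀ u, w u = (q - 1) * ((perpIn Q (Submodule.span F {u}) M).ncard -
      q ^ s * m u - t) := fun u => by
    simp only [w, hs]
    linear_combination ht
  have hw0 : ∀ u ∈ Y, w u = 0 := by
    refine eq_zero_of_eigenvector Y N m w _ _ (i * (q ^ s - 1)) hsymm (fun _ _ => rfl) hN hk ?_ ?_
    · have h1 : 1 ≤ q ^ (2 * s + 1) := one_le_pow₀ (by omega)
      have h2 : 0 < (q - 1) * q ^ s := mul_pos (by omega) hqs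
      omega
    · refine h.imp (fun h => Finset.sum_eq_zero fun u _ => ?_)
        fun h => Finset.sum_congr rfl fun u hu => ?_
      · by_cases hu : Submodule.span F {u} ∈ M
        · simp [hwd, h _ hu, m, hu]
        · simp [m, hu]
      · by_cases huM : Submodule.span F {u} ∈ M
        · simp [m, huM]
        · have h1 := h _ ⟨u, ((hY u).1 hu).1, ((hY u).1 hu).2, rfl⟩ huM
          simp [hwd, h1, m, huM]
  have hfin : ∀ P, IsSingularPoint Q P →
      ((perpIn Q P M).ncard : ℤ) = q ^ s * (if P ∈ M then 1 else 0) + t := by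
    rintro P ⟨u, hu, hQu, rfl⟩
    have h1 := hw0 u ((hY u).2 ⟨hu, hQu⟩)
    rw [hwd] at h1
    have h2 := (mul_eq_zero.1 h1).resolve_left (by omega)
    simp only [m] at h2
    linear_combination h2
  constructor
  · intro P hP
    rw [hfin P (hM P hP), if_pos hP, mul_one]
  · intro P hP hPM
    rw [hfin P hP, if_neg hPM, mul_zero, zero_add]

/-- Let `F` be a finite field of odd order `q`, `r ≥ 2`, and `V` a
`(2r+1)`-dimensional `F`-space with a quadratic form `Q` whose polar form is
nondegenerate and whose Witt index is `r` (parabolic quadric `Q(2r, q)`).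
Let `i ≥ 1` and `M` a set of singular points with `|M| = i(q^r − 1)/(q − 1)`.
The following are equivalent:
(1) `|P^⊥ ∩ M| = q^{r−1} + i(q^{r−1} − 1)/(q − 1)` for all `P ∈ M`;
(2) `|P^⊥ ∩ M| = i(q^{r−1} − 1)/(q − 1)` for all singular points `P ∉ M`;
(3) both (1) and (2), i.e. `M` is an `i`-tight set. -/
theorem stmt_15 {F V : Type*} [Field F] [Fintype F] [AddCommGroup V] [Module F V]
    (hodd : Odd (Fintype.card F))
    (Q : QuadraticForm F V) (r : ℕ) (hr : 2 ≤ r)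
    (hdim : Module.finrank F V = 2 * r + 1)
    (hnd : ∀ u : V, (∀ v : V, polarB Q u v = 0) → u = 0)
    (hwitt : ∃ W : Submodule F V, Module.finrank F ↥W = r ∧ ∀ v ∈ W, Q v = 0)
    (hwitt' : ¬ ∃ W : Submodule F V, Module.finrank F ↥W = r + 1 ∧ ∀ v ∈ W, Q v = 0)
    (i : ℕ) (hi : 1 ≤ i) (M : Set (Submodule F V))
    (hM : ∀ P ∈ M, IsSingularPoint Q P)
    (hcard : M.ncard = i * (Fintype.card F ^ r - 1) / (Fintype.card F - 1)) :
    List.TFAE [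
      ∀ P ∈ M, (perpIn Q P M).ncard =
        Fintype.card F ^ (r - 1) +
          i * (Fintype.card F ^ (r - 1) - 1) / (Fintype.card F - 1),
      ∀ P : Submodule F V, IsSingularPoint Q P → P ∉ M → (perpIn Q P M).ncard =
        i * (Fintype.card F ^ (r - 1) - 1) / (Fintype.card F - 1),
      (∀ P ∈ M, (perpIn Q P M).ncard =
        Fintype.card F ^ (r - 1) +
          i * (Fintype.card F ^ (r - 1) - 1) / (Fintype.card F - 1)) ∧
      ∀ P : Submodule F V, IsSingularPoint Q P → P ∉ M → (perpIn Q P M).ncard =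
        i * (Fintype.card F ^ (r - 1) - 1) / (Fintype.card F - 1)] := by
  have hfd : FiniteDimensional F V := Module.finite_of_finrank_pos (by omega)
  have hfinV : Finite V := Module.finite_of_finite F
  have hfV : Fintype V := Fintype.ofFinite V
  obtain ⟨s, rfl⟩ : ∃ s, r = s + 1 := ⟨r - 1, by omega⟩
  rw [Nat.add_sub_cancel]
  have hF : 2 ≤ Fintype.card F := Fintype.one_lt_card
  have hZ := ncard_singular_vectors Q (s + 1) hdim hnd hwitt hwitt'
  have hcardV : Nat.card V = Fintype.card F ^ (2 * s + 3) := by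
    rw [Module.natCard_eq_pow_finrank (K := F), Nat.card_eq_fintype_card, hdim]
    congr 1
  have hdiv : ∀ n, ((Fintype.card F : ℤ) - 1) *
      (i * (Fintype.card F ^ n - 1) / (Fintype.card F - 1) : ℕ) =
      (i : ℤ) * ((Fintype.card F : ℤ) ^ n - 1) := by
    intro n
    have h1 : Fintype.card F - 1 ∣ i * (Fintype.card F ^ n - 1) :=
      Dvd.dvd.mul_left (by simpa using Nat.sub_dvd_pow_sub_pow (Fintype.card F) 1 n) i
    have h2 := Nat.mul_div_cancel' h1
    have h3 : 1 ≤ Fintype.card F ^ n := Nat.one_le_pow _ _ (by omega)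
    have h4 : 1 ≤ Fintype.card F := by omega
    have h5 := congrArg (Nat.cast : ℕ → ℤ) h2
    rw [Nat.cast_mul, Nat.cast_mul, Nat.cast_sub h3, Nat.cast_sub h4] at h5
    simpa using h5
  have key := ncard_perpIn_of_or hF Q s hcardV hnd hZ M hM i
    (i * (Fintype.card F ^ s - 1) / (Fintype.card F - 1) : ℕ) (by rw [hcard]; exact hdiv (s + 1))
    (hdiv s)
  simp only [← Nat.cast_pow, ← Nat.cast_add, Nat.cast_inj] at key
  tfae_have 1 → 3 := fun h => key (Or.inl h)
  tfae_have 2 → 3 := fun h => key (Or.inr h)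
  tfae_have 3 → 1 := And.left
  tfae_have 3 → 2 := And.right
  tfae_finish
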